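/- No triangle-local probability distribution P on (Fin 2)³ has support exactly equal to {(0,1,1),(1,0,0),(1,1,1)}. -/

import Mathlib

/-- `P` is a local probability distribution in the triangle network: the three
sources are finite independent hidden variables, processed by stochastic
response kernels at the three observers. -/
def IsTriangleLocal (P : Fin 2 → Fin 2 → Fin 2 → ℝ) : Prop :=
  ∃ (nα nβ nγ : ℕ)
    (pα : Fin nα → ℝ) (pβ : Fin nβ → ℝ) (pγ : Fin nγ → ℝ)
    (PA : Fin 2 → Fin nβ → Fin nγ → ℝ)
    (PB : Fin 2 → Fin nγ → Fin nα → ℝ)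
    (PC : Fin 2 → Fin nα → Fin nβ → ℝ),
    (∀ α, 0 ≤ pα α) ∧ (∑ α, pα α) = 1 ∧
    (∀ β, 0 ≤ pβ β) ∧ (∑ β, pβ β) = 1 ∧
    (∀ γ, 0 ≤ pγ γ) ∧ (∑ γ, pγ γ) = 1 ∧
    (∀ a β γ, 0 ≤ PA a β γ) ∧ (∀ β γ, (∑ a, PA a β γ) = 1) ∧
    (∀ b γ α, 0 ≤ PB b γ α) ∧ (∀ γ α, (∑ b, PB b γ α) = 1) ∧
    (∀ c α β, 0 ≤ PC c α β) ∧ (∀ α β, (∑ c, PC c α β) = 1) ∧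
    (∀ a b c, P a b c =
      ∑ α, ∑ β, ∑ γ, pα α * pβ β * pγ γ * PA a β γ * PB b γ α * PC c α β)

/-- A response kernel assigns positive probability to some outcome. -/
theorem exists_pos_of_sum_eq_one {p : Fin 2 → ℝ} (h : ∑ a, p a = 1) : ∃ a, 0 < p a := by
  by_contra! hp
  linarith [Finset.sum_nonpos fun a (_ : a ∈ Finset.univ) => hp a]

/-- No triangle-local distribution has support exactly
`{(0,1,1),(1,0,0),(1,1,1)}`. -/
theorem no_triangle_local_P3 :
    ¬ ∃ P : Fin 2 → Fin 2 → Fin 2 → ℝ, IsTriangleLocal P ∧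
      ∀ a b c : Fin 2, (0 < P a b c ↔
        ((a, b, c) = ((0 : Fin 2), (1 : Fin 2), (1 : Fin 2)) ∨
         (a, b, c) = ((1 : Fin 2), (0 : Fin 2), (0 : Fin 2)) ∨
         (a, b, c) = ((1 : Fin 2), (1 : Fin 2), (1 : Fin 2)))) := by
  rintro ⟨P, ⟨nα, nβ, nγ, pα, pβ, pγ, PA, PB, PC, hα, -, hβ, -, hγ, -,
    hA, hA1, hB, hB1, hC, hC1, hP⟩, hS⟩
  have term_nonneg (a b c α β γ) :
      0 ≤ pα α * pβ β * pγ γ * PA a β γ * PB b γ α * PC c α β :=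
    mul_nonneg (mul_nonneg (mul_nonneg (mul_nonneg (mul_nonneg (hα α) (hβ β)) (hγ γ))
      (hA a β γ)) (hB b γ α)) (hC c α β)
  have P_pos {a b c α β γ} (h1 : 0 < pα α) (h2 : 0 < pβ β) (h3 : 0 < pγ γ)
      (h4 : 0 < PA a β γ) (h5 : 0 < PB b γ α) (h6 : 0 < PC c α β) : 0 < P a b c := by
    rw [hP]
    refine Finset.sum_pos' (fun α _ => Finset.sum_nonneg fun β _ => Finset.sum_nonneg
      fun γ _ => term_nonneg a b c α β γ) ⟨α, Finset.mem_univ _, ?_⟩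
    refine Finset.sum_pos' (fun β _ => Finset.sum_nonneg
      fun γ _ => term_nonneg a b c α β γ) ⟨β, Finset.mem_univ _, ?_⟩
    refine Finset.sum_pos' (fun γ _ => term_nonneg a b c α β γ) ⟨γ, Finset.mem_univ _, ?_⟩
    positivity
  have exists_of_pos {a b c} (h : 0 < P a b c) : ∃ α β γ, 0 < pα α ∧ 0 < pβ β ∧ 0 < pγ γ ∧
      0 < PA a β γ ∧ 0 < PB b γ α ∧ 0 < PC c α β := by
    rw [hP] at h
    obtain ⟨α, -, h⟩ := Finset.exists_lt_of_sum_lt (f := fun _ => (0 : ℝ)) (by simpa using h)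
    obtain ⟨β, -, h⟩ := Finset.exists_lt_of_sum_lt (f := fun _ => (0 : ℝ)) (by simpa using h)
    obtain ⟨γ, -, h⟩ := Finset.exists_lt_of_sum_lt (f := fun _ => (0 : ℝ)) (by simpa using h)
    have h0 := h.ne'
    simp only [ne_eq, mul_eq_zero, not_or] at h0
    obtain ⟨⟨⟨⟨⟨h1, h2⟩, h3⟩, h4⟩, h5⟩, h6⟩ := h0
    exact ⟨α, β, γ, (hα α).lt_of_ne' h1, (hβ β).lt_of_ne' h2, (hγ γ).lt_of_ne' h3,
      (hA a β γ).lt_of_ne' h4, (hB b γ α).lt_of_ne' h5, (hC c α β).lt_of_ne' h6⟩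
  obtain ⟨-, β₁, γ₁, -, hβ₁, hγ₁, hA₁, -, -⟩ := exists_of_pos ((hS 0 1 1).2 (by simp))
  obtain ⟨α₂, -, γ₂, hα₂, -, hγ₂, -, hB₂, -⟩ := exists_of_pos ((hS 1 0 0).2 (by simp))
  obtain ⟨b, hb⟩ := exists_pos_of_sum_eq_one (hB1 γ₁ α₂)
  obtain ⟨c, hc⟩ := exists_pos_of_sum_eq_one (hC1 α₂ β₁)
  obtain ⟨a, ha⟩ := exists_pos_of_sum_eq_one (hA1 β₁ γ₂)
  have hc1 : c = 1 := by
    have := (hS 0 b c).1 (P_pos hα₂ hβ₁ hγ₁ hA₁ hb hc)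
    simp only [Prod.mk.injEq] at this
    grind only
  have := (hS a 0 c).1 (P_pos hα₂ hβ₁ hγ₂ ha hB₂ hc)
  simp only [Prod.mk.injEq] at this
  grind only
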